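/- Soundness of Λ_R: every theorem of the proof system Λ_R is valid, i.e., true at every index of every finite-choice kiobt-model. -/

import Mathlib

namespace IEAUST

variable {Agent Mom : Type}

/-- Histories: maximal chains of moments. -/
abbrev Hist (lt : Mom → Mom → Prop) : Type _ := {s : Set Mom // IsMaxChain lt s}

/-- An index is a pair of a moment and a history passing through it. -/
structure Idx (lt : Mom → Mom → Prop) where
  mom : Mom
  hist : Hist lt
  mem : mom ∈ hist.val

/-- The ex ante information set of an agent at an index. -/
def exAnte {lt : Mom → Mom → Prop} (epi : Agent → Idx lt → Idx lt → Prop)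
    (a : Agent) (i : Idx lt) : Set (Idx lt) :=
  {j | ∃ (h'' : Hist lt) (p : j.mom ∈ h''.val), epi a i ⟨j.mom, h'', p⟩}

/-- A kiobt structure: branching time, choices, epistemic relations, intention
topologies and deontic value(s). -/
structure KiobtModel (Agent Mom : Type) (lt : Mom → Mom → Prop) where
  ags_fin : Finite Agent
  mom_ne : Nonempty Mom
  lt_irrefl : ∀ m, ¬ lt m m
  lt_trans : ∀ {m₁ m₂ m₃}, lt m₁ m₂ → lt m₂ m₃ → lt m₁ m₃
  no_bb : ∀ {m₁ m₂ m}, lt m₁ m → lt m₂ m → m₁ = m₂ ∨ lt m₁ m₂ ∨ lt m₂ m₁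
  Choice : Agent → Mom → Set (Set (Hist lt))
  choice_sub : ∀ a m, ∀ L ∈ Choice a m, ∀ h ∈ L, m ∈ (h : Hist lt).val
  choice_ne : ∀ a m, ∀ L ∈ Choice a m, L.Nonempty
  choice_cover : ∀ a m (h : Hist lt), m ∈ h.val → ∃ L ∈ Choice a m, h ∈ L
  choice_disj : ∀ a m, ∀ L ∈ Choice a m, ∀ L' ∈ Choice a m, ∀ h, h ∈ L → h ∈ L' → L = L'
  nc : ∀ a m m', lt m m' → ∀ h h' : Hist lt, m ∈ h.val → m ∈ h'.val →
        m' ∈ h.val → m' ∈ h'.val → ∀ L ∈ Choice a m, h ∈ L → h' ∈ L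
  ia : ∀ m (s : Agent → Set (Hist lt)), (∀ a, s a ∈ Choice a m) → (⋂ a, s a).Nonempty
  epi : Agent → Idx lt → Idx lt → Prop
  epi_equiv : ∀ a, Equivalence (epi a)
  oac : ∀ a (i j : Idx lt), epi a i j → ∀ L ∈ Choice a i.mom, i.hist ∈ L →
        ∀ h' ∈ L, ∀ p : i.mom ∈ (h' : Hist lt).val, epi a ⟨i.mom, h', p⟩ j
  unifH : ∀ a (i j : Idx lt), epi a i j → ∀ (h' : Hist lt) (p : i.mom ∈ h'.val),
        ∃ (h'' : Hist lt) (q : j.mom ∈ h''.val), epi a ⟨i.mom, h', p⟩ ⟨j.mom, h'', q⟩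
  tau : Agent → Idx lt → Set (Set (Idx lt))
  tau_sub : ∀ a i, ∀ U ∈ tau a i, U ⊆ exAnte epi a i
  tau_univ : ∀ a i, exAnte epi a i ∈ tau a i
  tau_empty : ∀ a i, (∅ : Set (Idx lt)) ∈ tau a i
  tau_inter : ∀ a i U V, U ∈ tau a i → V ∈ tau a i → U ∩ V ∈ tau a i
  tau_sUnion : ∀ a i (S : Set (Set (Idx lt))), S ⊆ tau a i → ⋃₀ S ∈ tau a i
  tau_ci : ∀ a i U V, U ∈ tau a i → V ∈ tau a i → U.Nonempty → V.Nonempty → (U ∩ V).Nonempty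
  tau_ki : ∀ a i j, exAnte epi a i = exAnte epi a j → tau a i = tau a j
  Value : Hist lt → ℝ
  val : ℕ → Set (Idx lt)

variable {lt : Mom → Mom → Prop}

/-- The model is finite-choice if every choice partition has finitely many cells. -/
def FiniteChoice (M : KiobtModel Agent Mom lt) : Prop :=
  ∀ a m, (M.Choice a m).Finite

/-- `State^m_β`. -/
def stateSet (M : KiobtModel Agent Mom lt) (b : Agent) (m : Mom) : Set (Set (Hist lt)) :=
  {S | ∃ s : Agent → Set (Hist lt), (∀ a, s a ∈ M.Choice a m) ∧
        S = ⋂ a ∈ {a : Agent | a ≠ b}, s a}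

/-- `X ≤ Y` (ordering used for objective dominance). -/
def leVal (M : KiobtModel Agent Mom lt) (X Y : Set (Hist lt)) : Prop :=
  ∀ h ∈ X, ∀ h' ∈ Y, M.Value h ≤ M.Value h'

/-- `X ≤_s Y` (ordering used for subjective dominance). -/
def leValS (M : KiobtModel Agent Mom lt) (X Y : Set (Hist lt)) : Prop :=
  ∀ h ∈ X, ∀ h' ∈ Y, M.Value h ≤ M.Value h'

/-- Objective dominance `L ≼ L'`. -/
def domO (M : KiobtModel Agent Mom lt) (a : Agent) (m : Mom) (L L' : Set (Hist lt)) : Prop :=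
  ∀ S ∈ stateSet M a m, leVal M (L ∩ S) (L' ∩ S)

/-- Strict objective dominance `L ≺ L'`. -/
def sdomO (M : KiobtModel Agent Mom lt) (a : Agent) (m : Mom) (L L' : Set (Hist lt)) : Prop :=
  domO M a m L L' ∧ ¬ domO M a m L' L

/-- `Optimal^m_α`. -/
def optimal (M : KiobtModel Agent Mom lt) (a : Agent) (m : Mom) : Set (Set (Hist lt)) :=
  {L | L ∈ M.Choice a m ∧ ¬ ∃ L' ∈ M.Choice a m, sdomO M a m L L'}

/-- `m ∼_α m'` for moments. -/
def momRel (M : KiobtModel Agent Mom lt) (a : Agent) (m m' : Mom) : Prop :=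
  ∃ (i j : Idx lt), i.mom = m ∧ j.mom = m' ∧ M.epi a i j

/-- The epistemic cluster `[L]^m_α` of `L ⊆ H_{m*}` at `m`. -/
def cluster (M : KiobtModel Agent Mom lt) (a : Agent) (mstar : Mom)
    (L : Set (Hist lt)) (m : Mom) : Set (Hist lt) :=
  {h | ∃ (p : m ∈ h.val) (hs : Hist lt), hs ∈ L ∧
        ∃ q : mstar ∈ hs.val, M.epi a ⟨mstar, hs, q⟩ ⟨m, h, p⟩}

/-- Subjective dominance `L ≼_s L'`. -/
def domS (M : KiobtModel Agent Mom lt) (a : Agent) (mstar : Mom)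
    (L L' : Set (Hist lt)) : Prop :=
  ∀ m, momRel M a mstar m → ∀ S ∈ stateSet M a m,
    leValS M (cluster M a mstar L m ∩ S) (cluster M a mstar L' m ∩ S)

/-- Strict subjective dominance `L ≺_s L'`. -/
def sdomS (M : KiobtModel Agent Mom lt) (a : Agent) (mstar : Mom)
    (L L' : Set (Hist lt)) : Prop :=
  domS M a mstar L L' ∧ ¬ domS M a mstar L' L

/-- `SOptimal^m_α`. -/
def soptimal (M : KiobtModel Agent Mom lt) (a : Agent) (m : Mom) : Set (Set (Hist lt)) :=
  {L | L ∈ M.Choice a m ∧ ¬ ∃ L' ∈ M.Choice a m, sdomS M a m L L'}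

/-- Formulas of the language `L_R` (atomic propositions indexed by `ℕ`). -/
inductive Formula (Agent : Type) : Type
  | atom : ℕ → Formula Agent
  | neg : Formula Agent → Formula Agent
  | conj : Formula Agent → Formula Agent → Formula Agent
  | box : Formula Agent → Formula Agent
  | stit : Agent → Formula Agent → Formula Agent
  | know : Agent → Formula Agent → Formula Agent
  | intend : Agent → Formula Agent → Formula Agent
  | oughtO : Agent → Formula Agent → Formula Agent
  | oughtS : Agent → Formula Agent → Formula Agent

/-- `◇φ := ¬□¬φ`. -/
def Formula.diam (φ : Formula Agent) : Formula Agent := .neg (.box (.neg φ))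

/-- Material implication `φ → ψ := ¬(φ ∧ ¬ψ)`. -/
def Formula.imp (φ ψ : Formula Agent) : Formula Agent := .neg (.conj φ (.neg ψ))

/-- Truth at an index of a (finite-choice) kiobt-model. -/
def truth (M : KiobtModel Agent Mom lt) : Formula Agent → Idx lt → Prop
  | .atom n, i => i ∈ M.val n
  | .neg φ, i => ¬ truth M φ i
  | .conj φ ψ, i => truth M φ i ∧ truth M ψ i
  | .box φ, i => ∀ (h' : Hist lt) (p : i.mom ∈ h'.val), truth M φ ⟨i.mom, h', p⟩
  | .stit a φ, i => ∀ L ∈ M.Choice a i.mom, i.hist ∈ L →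
      ∀ h' ∈ L, ∀ p : i.mom ∈ (h' : Hist lt).val, truth M φ ⟨i.mom, h', p⟩
  | .know a φ, i => ∀ j, M.epi a i j → truth M φ j
  | .intend a φ, i => ∃ U ∈ M.tau a i, U.Nonempty ∧ ∀ j ∈ U, truth M φ j
  | .oughtO a φ, i => ∀ L ∈ optimal M a i.mom, ∀ h' ∈ L,
      ∀ p : i.mom ∈ (h' : Hist lt).val, truth M φ ⟨i.mom, h', p⟩
  | .oughtS a φ, i => ∀ L ∈ soptimal M a i.mom, ∀ m', momRel M a i.mom m' →
      ∀ h' ∈ cluster M a i.mom L m', ∀ p : m' ∈ (h' : Hist lt).val, truth M φ ⟨m', h', p⟩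

/-- Purely propositional formulas, used to state the axiom schema of
propositional tautologies. -/
inductive PropForm : Type
  | var : ℕ → PropForm
  | neg : PropForm → PropForm
  | conj : PropForm → PropForm → PropForm

/-- Classical evaluation of a propositional form. -/
def PropForm.eval (v : ℕ → Prop) : PropForm → Prop
  | .var n => v n
  | .neg p => ¬ PropForm.eval v p
  | .conj p q => PropForm.eval v p ∧ PropForm.eval v q

/-- Substitute formulas for the variables of a propositional form. -/
def PropForm.toFormula (σ : ℕ → Formula Agent) : PropForm → Formula Agent
  | .var n => σ n
  | .neg p => .neg (PropForm.toFormula σ p)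
  | .conj p q => .conj (PropForm.toFormula σ p) (PropForm.toFormula σ q)

/-- `φ` is a substitution instance of a classical propositional tautology. -/
def Formula.isTautInstance (φ : Formula Agent) : Prop :=
  ∃ (p : PropForm) (σ : ℕ → Formula Agent),
    (∀ v : ℕ → Prop, PropForm.eval v p) ∧ φ = PropForm.toFormula σ p

/-- Uniform substitution of formulas for atomic propositions. -/
def Formula.subst (σ : ℕ → Formula Agent) : Formula Agent → Formula Agent
  | .atom n => σ n
  | .neg φ => .neg (Formula.subst σ φ)
  | .conj φ ψ => .conj (Formula.subst σ φ) (Formula.subst σ ψ)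
  | .box φ => .box (Formula.subst σ φ)
  | .stit a φ => .stit a (Formula.subst σ φ)
  | .know a φ => .know a (Formula.subst σ φ)
  | .intend a φ => .intend a (Formula.subst σ φ)
  | .oughtO a φ => .oughtO a (Formula.subst σ φ)
  | .oughtS a φ => .oughtS a (Formula.subst σ φ)

/-- Conjunction of a nonempty list of formulas (head and tail). -/
def bigConj : Formula Agent → List (Formula Agent) → Formula Agent
  | φ, [] => φ
  | φ, ψ :: l => .conj φ (bigConj ψ l)

/-- The proof system `Lambda_R`. -/
inductive Lambda_R {Agent : Type} : Formula Agent → Prop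
  /-- All classical propositional tautologies. -/
  | taut {φ : Formula Agent} : φ.isTautInstance → Lambda_R φ
  /-- S5 for `□`: K. -/
  | boxK (φ ψ : Formula Agent) :
      Lambda_R ((Formula.box (φ.imp ψ)).imp ((Formula.box φ).imp (Formula.box ψ)))
  /-- S5 for `□`: T. -/
  | boxT (φ : Formula Agent) : Lambda_R ((Formula.box φ).imp φ)
  /-- S5 for `□`: 5. -/
  | box5 (φ : Formula Agent) :
      Lambda_R ((Formula.diam φ).imp (Formula.box (Formula.diam φ)))
  /-- S5 for `[α]`: K. -/
  | stitK (a : Agent) (φ ψ : Formula Agent) :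
      Lambda_R ((Formula.stit a (φ.imp ψ)).imp ((Formula.stit a φ).imp (Formula.stit a ψ)))
  /-- S5 for `[α]`: T. -/
  | stitT (a : Agent) (φ : Formula Agent) : Lambda_R ((Formula.stit a φ).imp φ)
  /-- S5 for `[α]`: 5. -/
  | stit5 (a : Agent) (φ : Formula Agent) :
      Lambda_R ((Formula.neg (Formula.stit a (Formula.neg φ))).imp
        (Formula.stit a (Formula.neg (Formula.stit a (Formula.neg φ)))))
  /-- S5 for `K_α`: K. -/
  | knowK (a : Agent) (φ ψ : Formula Agent) :
      Lambda_R ((Formula.know a (φ.imp ψ)).imp ((Formula.know a φ).imp (Formula.know a ψ)))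
  /-- S5 for `K_α`: T. -/
  | knowT (a : Agent) (φ : Formula Agent) : Lambda_R ((Formula.know a φ).imp φ)
  /-- S5 for `K_α`: 5. -/
  | know5 (a : Agent) (φ : Formula Agent) :
      Lambda_R ((Formula.neg (Formula.know a (Formula.neg φ))).imp
        (Formula.know a (Formula.neg (Formula.know a (Formula.neg φ)))))
  /-- KD for `I_α`: K. -/
  | intK (a : Agent) (φ ψ : Formula Agent) :
      Lambda_R ((Formula.intend a (φ.imp ψ)).imp
        ((Formula.intend a φ).imp (Formula.intend a ψ)))
  /-- KD for `I_α`: D. -/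
  | intD (a : Agent) (φ : Formula Agent) :
      Lambda_R ((Formula.intend a φ).imp (Formula.neg (Formula.intend a (Formula.neg φ))))
  /-- (SET). -/
  | set (a : Agent) (φ : Formula Agent) : Lambda_R ((Formula.box φ).imp (Formula.stit a φ))
  /-- (IA), for pairwise-distinct agents. -/
  | indep (p : Agent × Formula Agent) (l : List (Agent × Formula Agent))
      (hd : ((p :: l).map Prod.fst).Nodup) :
      Lambda_R ((bigConj (Formula.diam (Formula.stit p.1 p.2))
          (l.map fun q => Formula.diam (Formula.stit q.1 q.2))).imp
        (Formula.diam (bigConj (Formula.stit p.1 p.2)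
          (l.map fun q => Formula.stit q.1 q.2))))
  /-- (OAC). -/
  | oac (a : Agent) (φ : Formula Agent) : Lambda_R ((Formula.know a φ).imp (Formula.stit a φ))
  /-- (Unif-H). -/
  | unifH (a : Agent) (φ : Formula Agent) :
      Lambda_R ((Formula.diam (Formula.know a φ)).imp (Formula.know a (Formula.diam φ)))
  /-- (A1). -/
  | a1 (a : Agent) (φ ψ : Formula Agent) :
      Lambda_R ((Formula.oughtO a (φ.imp ψ)).imp
        ((Formula.oughtO a φ).imp (Formula.oughtO a ψ)))
  /-- (A2). -/
  | a2 (a : Agent) (φ : Formula Agent) : Lambda_R ((Formula.box φ).imp (Formula.oughtO a φ))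
  /-- (A3). -/
  | a3 (a : Agent) (φ : Formula Agent) :
      Lambda_R ((Formula.oughtO a φ).imp (Formula.box (Formula.oughtO a φ)))
  /-- (A4). -/
  | a4 (a : Agent) (φ : Formula Agent) :
      Lambda_R ((Formula.oughtO a φ).imp (Formula.oughtO a (Formula.stit a φ)))
  /-- (Oic). -/
  | oic (a : Agent) (φ : Formula Agent) :
      Lambda_R ((Formula.oughtO a φ).imp (Formula.diam (Formula.stit a φ)))
  /-- (A5). -/
  | a5 (a : Agent) (φ ψ : Formula Agent) :
      Lambda_R ((Formula.oughtS a (φ.imp ψ)).imp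
        ((Formula.oughtS a φ).imp (Formula.oughtS a ψ)))
  /-- (A6). -/
  | a6 (a : Agent) (φ : Formula Agent) :
      Lambda_R ((Formula.oughtS a φ).imp (Formula.oughtS a (Formula.know a φ)))
  /-- (SuN). -/
  | suN (a : Agent) (φ : Formula Agent) :
      Lambda_R ((Formula.know a (Formula.box φ)).imp (Formula.oughtS a φ))
  /-- (s.Oic). -/
  | sOic (a : Agent) (φ : Formula Agent) :
      Lambda_R ((Formula.oughtS a φ).imp (Formula.diam (Formula.know a φ)))
  /-- (s.Cl). -/
  | sCl (a : Agent) (φ : Formula Agent) :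
      Lambda_R ((Formula.oughtS a φ).imp (Formula.know a (Formula.box (Formula.oughtS a φ))))
  /-- (ConSO). -/
  | conSO (a : Agent) (φ : Formula Agent) :
      Lambda_R ((Formula.oughtS a φ).imp (Formula.neg (Formula.oughtO a (Formula.neg φ))))
  /-- (InN). -/
  | inN (a : Agent) (φ : Formula Agent) :
      Lambda_R ((Formula.box (Formula.know a φ)).imp (Formula.intend a φ))
  /-- (KI). -/
  | ki (a : Agent) (φ : Formula Agent) :
      Lambda_R ((Formula.intend a φ).imp (Formula.box (Formula.know a (Formula.intend a φ))))
  /-- Modus ponens. -/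
  | mp {φ ψ : Formula Agent} : Lambda_R (φ.imp ψ) → Lambda_R φ → Lambda_R ψ
  /-- Uniform substitution. -/
  | subst {φ : Formula Agent} (σ : ℕ → Formula Agent) :
      Lambda_R φ → Lambda_R (φ.subst σ)
  /-- Necessitation for `□`. -/
  | necBox {φ : Formula Agent} : Lambda_R φ → Lambda_R (Formula.box φ)
  /-- Necessitation for `[α]`. -/
  | necStit (a : Agent) {φ : Formula Agent} : Lambda_R φ → Lambda_R (Formula.stit a φ)
  /-- Necessitation for `K_α`. -/
  | necKnow (a : Agent) {φ : Formula Agent} : Lambda_R φ → Lambda_R (Formula.know a φ)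
  /-- Necessitation for `I_α`. -/
  | necInt (a : Agent) {φ : Formula Agent} : Lambda_R φ → Lambda_R (Formula.intend a φ)
  /-- Necessitation for `⊙_α`. -/
  | necOO (a : Agent) {φ : Formula Agent} : Lambda_R φ → Lambda_R (Formula.oughtO a φ)
  /-- Necessitation for `⊙^S_α`. -/
  | necOS (a : Agent) {φ : Formula Agent} : Lambda_R φ → Lambda_R (Formula.oughtS a φ)

/-- Above every element of a finite set there is an element that is not strictly dominated. -/
theorem exists_undominated {β : Type*} {C : Set β} (hC : C.Finite) (r : β → β → Prop)
    (htrans : ∀ x ∈ C, ∀ y ∈ C, ∀ z ∈ C, r x y → r y z → r x z) {x : β} (hx : x ∈ C) :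
    ∃ y ∈ C, (y = x ∨ r x y) ∧ ¬ ∃ z ∈ C, r y z ∧ ¬ r z y := by
  have : Finite C := hC
  let : Preorder C :=
    { le := fun u v => v = u ∨ r u v
      le_refl := fun u => Or.inl rfl
      le_trans := by
        rintro u v w (rfl | h₁) (rfl | h₂)
        · exact Or.inl rfl
        · exact Or.inr h₂
        · exact Or.inr h₁
        · exact Or.inr (htrans _ u.2 _ v.2 _ w.2 h₁ h₂) }
  obtain ⟨y, hxy, -, hy⟩ :=
    (Set.toFinite (Set.univ : Set C)).exists_le_maximal (Set.mem_univ ⟨x, hx⟩)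
  refine ⟨y, y.2, hxy.imp (congrArg Subtype.val) id, ?_⟩
  rintro ⟨z, hz, hyz, hzy⟩
  rcases hy (Set.mem_univ (⟨z, hz⟩ : C)) (Or.inr hyz) with h | h
  · subst h
    exact hzy hyz
  · exact hzy h

section Semantics

variable (M : KiobtModel Agent Mom lt)

theorem truth_imp (φ ψ : Formula Agent) (i : Idx lt) :
    truth M (φ.imp ψ) i ↔ (truth M φ i → truth M ψ i) := by
  simp only [Formula.imp, truth, not_and, not_not]

theorem truth_diam (φ : Formula Agent) (i : Idx lt) :
    truth M φ.diam i ↔ ∃ (h : Hist lt) (p : i.mom ∈ h.val), truth M φ ⟨i.mom, h, p⟩ := by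
  simp only [Formula.diam, truth, not_forall, not_not]

theorem truth_bigConj (φ : Formula Agent) (l : List (Formula Agent)) (i : Idx lt) :
    truth M (bigConj φ l) i ↔ ∀ ψ ∈ φ :: l, truth M ψ i := by
  induction l generalizing φ with
  | nil => simp [bigConj]
  | cons χ l ih => simp only [bigConj, truth, ih, List.forall_mem_cons]

theorem truth_toFormula (σ : ℕ → Formula Agent) (p : PropForm) (i : Idx lt) :
    truth M (p.toFormula σ) i ↔ p.eval fun n => truth M (σ n) i := by
  induction p with
  | var n => rfl
  | neg p ih => simp only [PropForm.toFormula, PropForm.eval, truth, ih]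
  | conj p q ihp ihq => simp only [PropForm.toFormula, PropForm.eval, truth, ihp, ihq]

/-- Truth of a substitution instance is truth in the model with the reinterpreted valuation. -/
theorem truth_subst (σ : ℕ → Formula Agent) (φ : Formula Agent) (i : Idx lt) :
    truth M (φ.subst σ) i ↔ truth { M with val := fun n => {j | truth M (σ n) j} } φ i := by
  induction φ generalizing i with
  | atom n => rfl
  | neg φ ih => exact not_congr (ih i)
  | conj φ ψ ihφ ihψ => exact and_congr (ihφ i) (ihψ i)
  | box φ ih => exact forall₂_congr fun h p => ih _
  | stit a φ ih =>
    exact forall₃_congr fun L _ _ => forall₃_congr fun h _ p => ih _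
  | know a φ ih => exact forall₂_congr fun j _ => ih j
  | intend a φ ih =>
    exact exists_congr fun U => and_congr Iff.rfl <| and_congr Iff.rfl <|
      forall₂_congr fun j _ => ih j
  | oughtO a φ ih =>
    exact forall₂_congr fun L _ => forall₃_congr fun h _ p => ih _
  | oughtS a φ ih =>
    exact forall₂_congr fun L _ => forall₂_congr fun m _ => forall₃_congr fun h _ p => ih _

/-- A cell of an agent meets every state of that agent. -/
theorem choice_inter_state_nonempty {a : Agent} {m : Mom} {L S : Set (Hist lt)}
    (hL : L ∈ M.Choice a m) (hS : S ∈ stateSet M a m) : (L ∩ S).Nonempty := by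
  classical
  obtain ⟨s, hs, rfl⟩ := hS
  obtain ⟨h, hh⟩ := M.ia m (Function.update s a L) fun b => by
    by_cases hb : b = a
    · subst hb
      simpa using hL
    · simpa [hb] using hs b
  rw [Set.mem_iInter] at hh
  refine ⟨h, by simpa using hh a, Set.mem_iInter₂.2 fun b hb => ?_⟩
  simpa [show b ≠ a from hb] using hh b

theorem leVal_trans {X Y Z : Set (Hist lt)} (hY : Y.Nonempty) (hXY : leVal M X Y)
    (hYZ : leVal M Y Z) : leVal M X Z := fun h hh h' hh' =>
  let ⟨_, hk⟩ := hY
  (hXY h hh _ hk).trans (hYZ _ hk h' hh')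

theorem domO_trans {a : Agent} {m : Mom} {L₁ L₂ L₃ : Set (Hist lt)} (h₂ : L₂ ∈ M.Choice a m)
    (h₁₂ : domO M a m L₁ L₂) (h₂₃ : domO M a m L₂ L₃) : domO M a m L₁ L₃ := fun S hS =>
  leVal_trans M (choice_inter_state_nonempty M h₂ hS) (h₁₂ S hS) (h₂₃ S hS)

theorem exAnte_eq_of_epi {a : Agent} {i j : Idx lt} (hij : M.epi a i j) :
    exAnte M.epi a i = exAnte M.epi a j :=
  Set.ext fun _ => exists₂_congr fun _ _ =>
    ⟨(M.epi_equiv a).trans ((M.epi_equiv a).symm hij), (M.epi_equiv a).trans hij⟩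

theorem exAnte_eq_of_mom_eq (a : Agent) (i : Idx lt) (h : Hist lt) (p : i.mom ∈ h.val) :
    exAnte M.epi a ⟨i.mom, h, p⟩ = exAnte M.epi a i := by
  ext k
  constructor
  · rintro ⟨g, q, e⟩
    exact M.unifH a _ _ e i.hist i.mem
  · rintro ⟨g, q, e⟩
    exact M.unifH a _ _ e h p

theorem self_mem_exAnte (a : Agent) (i : Idx lt) : i ∈ exAnte M.epi a i :=
  ⟨i.hist, i.mem, (M.epi_equiv a).refl i⟩

theorem momRel_of_epi {a : Agent} {i j : Idx lt} (e : M.epi a i j) :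
    momRel M a i.mom j.mom :=
  ⟨i, j, rfl, rfl, e⟩

theorem momRel_refl (a : Agent) (i : Idx lt) : momRel M a i.mom i.mom :=
  momRel_of_epi M ((M.epi_equiv a).refl i)

theorem momRel_symm {a : Agent} {m m' : Mom} (hm : momRel M a m m') : momRel M a m' m :=
  let ⟨i, j, hi, hj, e⟩ := hm
  ⟨j, i, hj, hi, (M.epi_equiv a).symm e⟩

/-- Uniformity of historical possibility, phrased for related moments. -/
theorem exists_epi_of_momRel {a : Agent} {m m' : Mom} (hm : momRel M a m m') (h : Hist lt)
    (p : m ∈ h.val) :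
    ∃ (h' : Hist lt) (q : m' ∈ h'.val), M.epi a ⟨m, h, p⟩ ⟨m', h', q⟩ := by
  obtain ⟨i, j, rfl, rfl, e⟩ := hm
  exact M.unifH a i j e h p

theorem momRel_trans {a : Agent} {m₁ m₂ m₃ : Mom} (h₁₂ : momRel M a m₁ m₂)
    (h₂₃ : momRel M a m₂ m₃) : momRel M a m₁ m₃ := by
  obtain ⟨i, j, hi, rfl, e⟩ := h₁₂
  obtain ⟨h, q, e'⟩ := exists_epi_of_momRel M h₂₃ j.hist j.mem
  exact ⟨i, _, hi, rfl, (M.epi_equiv a).trans e e'⟩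

theorem epi_of_mem_choice {a : Agent} {m : Mom} {L : Set (Hist lt)} (hL : L ∈ M.Choice a m)
    {h h' : Hist lt} (hh : h ∈ L) (hh' : h' ∈ L) (p : m ∈ h.val) (p' : m ∈ h'.val) :
    M.epi a ⟨m, h, p⟩ ⟨m, h', p'⟩ :=
  M.oac a ⟨m, h', p'⟩ ⟨m, h', p'⟩ ((M.epi_equiv a).refl _) L hL hh' h hh p

theorem mem_cluster_of_epi {a : Agent} {m m' : Mom} {L : Set (Hist lt)} {h h' : Hist lt}
    (hh : h ∈ L) {p : m ∈ h.val} {p' : m' ∈ h'.val} (e : M.epi a ⟨m, h, p⟩ ⟨m', h', p'⟩) :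
    h' ∈ cluster M a m L m' :=
  ⟨p', h, hh, p, e⟩

theorem subset_cluster_self {a : Agent} {m : Mom} {L : Set (Hist lt)}
    (hL : L ∈ M.Choice a m) : L ⊆ cluster M a m L m := fun h hh =>
  mem_cluster_of_epi M hh (p := M.choice_sub a m L hL h hh) ((M.epi_equiv a).refl _)

/-- The cluster of a cell meets every state at every related moment. -/
theorem cluster_inter_state_nonempty {a : Agent} {m m' : Mom} {L S : Set (Hist lt)}
    (hL : L ∈ M.Choice a m) (hm : momRel M a m m') (hS : S ∈ stateSet M a m') :
    (cluster M a m L m' ∩ S).Nonempty := by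
  obtain ⟨h, hh⟩ := M.choice_ne a m L hL
  obtain ⟨h', q, e⟩ := exists_epi_of_momRel M hm h (M.choice_sub a m L hL h hh)
  obtain ⟨K, hK, hK'⟩ := M.choice_cover a m' h' q
  obtain ⟨g, hgK, hgS⟩ := choice_inter_state_nonempty M hK hS
  exact ⟨g, mem_cluster_of_epi M hh ((M.epi_equiv a).trans e
    (epi_of_mem_choice M hK hK' hgK q (M.choice_sub a m' K hK g hgK))), hgS⟩

theorem domS_trans {a : Agent} {m : Mom} {L₁ L₂ L₃ : Set (Hist lt)} (h₂ : L₂ ∈ M.Choice a m)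
    (h₁₂ : domS M a m L₁ L₂) (h₂₃ : domS M a m L₂ L₃) : domS M a m L₁ L₃ := fun m' hm S hS =>
  leVal_trans M (cluster_inter_state_nonempty M h₂ hm hS) (h₁₂ m' hm S hS) (h₂₃ m' hm S hS)

theorem domO_of_domS {a : Agent} (i : Idx lt) {L L' : Set (Hist lt)}
    (hL : L ∈ M.Choice a i.mom) (hL' : L' ∈ M.Choice a i.mom)
    (h : domS M a i.mom L L') : domO M a i.mom L L' := fun S hS g hg g' hg' =>
  h i.mom (momRel_refl M a i) S hS g ⟨subset_cluster_self M hL hg.1, hg.2⟩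
    g' ⟨subset_cluster_self M hL' hg'.1, hg'.2⟩

/-- A cell at a moment has a counterpart with the same clusters at every related moment. -/
theorem exists_cluster_eq {a : Agent} {m m' : Mom} (hm : momRel M a m m') {L : Set (Hist lt)}
    (hL : L ∈ M.Choice a m) :
    ∃ L' ∈ M.Choice a m', ∀ n, cluster M a m L n = cluster M a m' L' n := by
  obtain ⟨h, hh⟩ := M.choice_ne a m L hL
  have p := M.choice_sub a m L hL h hh
  obtain ⟨h', p', e⟩ := exists_epi_of_momRel M hm h p
  obtain ⟨L', hL', hh'⟩ := M.choice_cover a m' h' p'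
  refine ⟨L', hL', fun n => Set.ext fun g => ⟨?_, ?_⟩⟩
  · rintro ⟨q, k, hk, r, e'⟩
    exact mem_cluster_of_epi M hh' ((M.epi_equiv a).trans ((M.epi_equiv a).symm e)
      ((M.epi_equiv a).trans (epi_of_mem_choice M hL hh hk p r) e'))
  · rintro ⟨q, k, hk, r, e'⟩
    exact mem_cluster_of_epi M hh ((M.epi_equiv a).trans e
      ((M.epi_equiv a).trans (epi_of_mem_choice M hL' hh' hk p' r) e'))

theorem domS_of_cluster_eq {a : Agent} {m m' : Mom} (hm : momRel M a m m')
    {L K L' K' : Set (Hist lt)} (hL : ∀ n, cluster M a m L n = cluster M a m' L' n)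
    (hK : ∀ n, cluster M a m K n = cluster M a m' K' n) (h : domS M a m L K) :
    domS M a m' L' K' := fun n hn S hS => by
  rw [← hL, ← hK]
  exact h n (momRel_trans M hm hn) S hS

/-- Subjectively optimal cells have subjectively optimal counterparts at related moments. -/
theorem exists_soptimal_cluster_eq {a : Agent} {m m' : Mom} (hm : momRel M a m m')
    {L : Set (Hist lt)} (hL : L ∈ soptimal M a m) :
    ∃ L' ∈ soptimal M a m', ∀ n, cluster M a m L n = cluster M a m' L' n := by
  obtain ⟨L', hL', hLL'⟩ := exists_cluster_eq M hm hL.1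
  refine ⟨L', ⟨hL', ?_⟩, hLL'⟩
  rintro ⟨K', hK', hdom, hndom⟩
  obtain ⟨K, hK, hKK'⟩ := exists_cluster_eq M (momRel_symm M hm) hK'
  exact hL.2 ⟨K, hK,
    domS_of_cluster_eq M (momRel_symm M hm) (fun n => (hLL' n).symm) hKK' hdom,
    fun h => hndom (domS_of_cluster_eq M hm (fun n => (hKK' n).symm) hLL' h)⟩

theorem exists_optimal (hM : FiniteChoice M) (a : Agent) (i : Idx lt) :
    ∃ L, L ∈ optimal M a i.mom := by
  obtain ⟨L, hL, -⟩ := M.choice_cover a i.mom i.hist i.mem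
  obtain ⟨K, hK, -, hK'⟩ := exists_undominated (hM a i.mom) (domO M a i.mom)
    (fun _ _ _ hy _ _ => domO_trans M hy) hL
  exact ⟨K, hK, hK'⟩

theorem exists_soptimal_dominating (hM : FiniteChoice M) (a : Agent) {m : Mom}
    {L : Set (Hist lt)} (hL : L ∈ M.Choice a m) :
    ∃ K ∈ soptimal M a m, K = L ∨ domS M a m L K := by
  obtain ⟨K, hK, hLK, hK'⟩ := exists_undominated (hM a m) (domS M a m)
    (fun _ _ _ hy _ _ => domS_trans M hy) hL
  exact ⟨K, ⟨hK, hK'⟩, hLK⟩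

/-- Some cell is both objectively and subjectively optimal. -/
theorem exists_optimal_soptimal (hM : FiniteChoice M) (a : Agent) (i : Idx lt) :
    ∃ L, L ∈ optimal M a i.mom ∧ L ∈ soptimal M a i.mom := by
  obtain ⟨L, hL⟩ := exists_optimal M hM a i
  obtain ⟨K, hK, rfl | hLK⟩ := exists_soptimal_dominating M hM a hL.1
  · exact ⟨K, hL, hK⟩
  · have hLK' := domO_of_domS M i hL.1 hK.1 hLK
    refine ⟨K, ⟨hK.1, ?_⟩, hK⟩
    rintro ⟨K', hK', hdom, hndom⟩
    exact hL.2 ⟨K', hK', domO_trans M hK.1 hLK' hdom, fun h => hndom (domO_trans M hL.1 h hLK')⟩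

theorem truth_indep (p : Agent × Formula Agent) (l : List (Agent × Formula Agent))
    (hd : ((p :: l).map Prod.fst).Nodup) (i : Idx lt)
    (h : truth M (bigConj (Formula.diam (Formula.stit p.1 p.2))
      (l.map fun q => Formula.diam (Formula.stit q.1 q.2))) i) :
    truth M (Formula.diam (bigConj (Formula.stit p.1 p.2)
      (l.map fun q => Formula.stit q.1 q.2))) i := by
  have h' : ∀ q ∈ p :: l, truth M (Formula.diam (Formula.stit q.1 q.2)) i := fun q hq =>
    (truth_bigConj M _ _ i).1 h _ (List.mem_map_of_mem
      (f := fun q : Agent × Formula Agent => Formula.diam (Formula.stit q.1 q.2)) hq)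
  have cells : ∀ a, ∃ L ∈ M.Choice a i.mom, ∀ q ∈ p :: l, q.1 = a →
      ∀ g ∈ L, ∀ r : i.mom ∈ (g : Hist lt).val, truth M q.2 ⟨i.mom, g, r⟩ := by
    intro a
    by_cases ha : ∃ q ∈ p :: l, q.1 = a
    · obtain ⟨q, hq, rfl⟩ := ha
      obtain ⟨g, r, hg⟩ := (truth_diam M _ i).1 (h' q hq)
      obtain ⟨L, hL, hgL⟩ := M.choice_cover q.1 i.mom g r
      refine ⟨L, hL, fun q' hq' heq => ?_⟩
      obtain rfl := List.inj_on_of_nodup_map hd hq' hq heq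
      exact hg L hL hgL
    · obtain ⟨L, hL, -⟩ := M.choice_cover a i.mom i.hist i.mem
      exact ⟨L, hL, fun q hq heq => absurd ⟨q, hq, heq⟩ ha⟩
  choose s hs hs' using cells
  obtain ⟨g, hg⟩ := M.ia i.mom s hs
  rw [Set.mem_iInter] at hg
  refine (truth_diam M _ i).2 ⟨g, M.choice_sub p.1 i.mom _ (hs p.1) g (hg p.1),
    (truth_bigConj M _ _ _).2 fun ψ hψ => ?_⟩
  obtain ⟨q, hq, rfl⟩ : ∃ q ∈ p :: l, Formula.stit q.1 q.2 = ψ := List.mem_map.1 hψ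
  intro L hL hgL k hk r
  obtain rfl := M.choice_disj q.1 i.mom L hL (s q.1) (hs q.1) g hgL (hg q.1)
  exact hs' q.1 q hq rfl k hk r

end Semantics

/-- soundness of `Λ_R` with respect to finite-choice kiobt-models. -/
theorem Lambda_R_sound {Agent : Type} [Finite Agent] (φ : Formula Agent)
    (hφ : Lambda_R φ) :
    ∀ (Mom : Type) (lt : Mom → Mom → Prop) (M : KiobtModel Agent Mom lt),
      FiniteChoice M → ∀ i : Idx lt, truth M φ i := by
  intro Mom lt M hM i
  induction hφ generalizing M i with
  | taut h =>
    obtain ⟨p, σ, hp, rfl⟩ := h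
    exact (truth_toFormula M σ p i).2 (hp _)
  | boxK φ ψ =>
    simp only [truth_imp, truth]
    exact fun h₁ h₂ h p => h₁ h p (h₂ h p)
  | boxT φ =>
    simp only [truth_imp, truth]
    exact fun h => h i.hist i.mem
  | box5 φ =>
    simp only [truth_imp, truth, truth_diam]
    exact fun h _ _ => h
  | stitK a φ ψ =>
    simp only [truth_imp, truth]
    exact fun h₁ h₂ L hL hi h hh p => h₁ L hL hi h hh p (h₂ L hL hi h hh p)
  | stitT a φ =>
    simp only [truth_imp, truth]
    intro h
    obtain ⟨L, hL, hi⟩ := M.choice_cover a i.mom i.hist i.mem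
    exact h L hL hi i.hist hi i.mem
  | stit5 a φ =>
    simp only [truth_imp, truth]
    intro h L hL hi g hg p h'
    refine h fun K hK hiK k hk q => ?_
    obtain rfl := M.choice_disj a i.mom L hL K hK i.hist hi hiK
    exact h' L hL hg k hk q
  | knowK a φ ψ =>
    simp only [truth_imp, truth]
    exact fun h₁ h₂ j e => h₁ j e (h₂ j e)
  | knowT a φ =>
    simp only [truth_imp, truth]
    exact fun h => h i ((M.epi_equiv a).refl i)
  | know5 a φ =>
    simp only [truth_imp, truth]
    exact fun h j e h' => h fun k e' =>
      h' k ((M.epi_equiv a).trans ((M.epi_equiv a).symm e) e')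
  | intK a φ ψ =>
    simp only [truth_imp, truth]
    rintro ⟨U, hU, hUne, hUt⟩ ⟨V, hV, hVne, hVt⟩
    exact ⟨U ∩ V, M.tau_inter a i U V hU hV, M.tau_ci a i U V hU hV hUne hVne,
      fun j hj => hUt j hj.1 (hVt j hj.2)⟩
  | intD a φ =>
    simp only [truth_imp, truth]
    rintro ⟨U, hU, hUne, hUt⟩ ⟨V, hV, hVne, hVt⟩
    obtain ⟨j, hjU, hjV⟩ := M.tau_ci a i U V hU hV hUne hVne
    exact hVt j hjV (hUt j hjU)
  | set a φ =>
    simp only [truth_imp, truth]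
    exact fun h _ _ _ g _ p => h g p
  | indep p l hd => exact (truth_imp M _ _ i).2 (truth_indep M p l hd i)
  | oac a φ =>
    simp only [truth_imp, truth]
    exact fun h L hL hi g hg p => h _ (epi_of_mem_choice M hL hi hg i.mem p)
  | unifH a φ =>
    simp only [truth_imp, truth, truth_diam]
    rintro ⟨h, p, hh⟩ j e
    obtain ⟨g, q, e'⟩ := M.unifH a i j e h p
    exact ⟨g, q, hh _ e'⟩
  | a1 a φ ψ =>
    simp only [truth_imp, truth]
    exact fun h₁ h₂ L hL h hh p => h₁ L hL h hh p (h₂ L hL h hh p)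
  | a2 a φ =>
    simp only [truth_imp, truth]
    exact fun h _ _ g _ p => h g p
  | a3 a φ =>
    simp only [truth_imp, truth]
    exact fun h _ _ => h
  | a4 a φ =>
    simp only [truth_imp, truth]
    intro h L hL g hg p K hK hgK
    obtain rfl := M.choice_disj a i.mom L hL.1 K hK g hg hgK
    exact h L hL
  | oic a φ =>
    simp only [truth_imp, truth, truth_diam]
    intro h
    obtain ⟨L, hL⟩ := exists_optimal M hM a i
    obtain ⟨g, hg⟩ := M.choice_ne a i.mom L hL.1
    refine ⟨g, M.choice_sub a i.mom L hL.1 g hg, fun K hK hgK => ?_⟩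
    obtain rfl := M.choice_disj a i.mom L hL.1 K hK g hg hgK
    exact h L hL
  | a5 a φ ψ =>
    simp only [truth_imp, truth]
    exact fun h₁ h₂ L hL m hm h hh p => h₁ L hL m hm h hh p (h₂ L hL m hm h hh p)
  | a6 a φ =>
    simp only [truth_imp, truth]
    rintro h L hL m hm g ⟨_, k, hk, q, e⟩ p j e'
    have e'' := (M.epi_equiv a).trans e e'
    exact h L hL j.mom (momRel_of_epi M (i := ⟨i.mom, k, q⟩) e'') j.hist
      (mem_cluster_of_epi M hk e'') j.mem
  | suN a φ =>
    simp only [truth_imp, truth]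
    intro h L hL m hm g hg p
    obtain ⟨g', q, e⟩ := exists_epi_of_momRel M hm i.hist i.mem
    exact h _ e g p
  | sOic a φ =>
    simp only [truth_imp, truth, truth_diam]
    intro h
    obtain ⟨L, -, hL⟩ := exists_optimal_soptimal M hM a i
    obtain ⟨g, hg⟩ := M.choice_ne a i.mom L hL.1
    exact ⟨g, M.choice_sub a i.mom L hL.1 g hg, fun j e =>
      h L hL j.mom (momRel_of_epi M (i := ⟨i.mom, g, _⟩) e) j.hist
        (mem_cluster_of_epi M hg e) j.mem⟩
  | sCl a φ =>
    simp only [truth_imp, truth]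
    intro h j e _ _ L hL m hm g hg p
    have hij := momRel_of_epi M e
    obtain ⟨K, hK, hLK⟩ := exists_soptimal_cluster_eq M (momRel_symm M hij) hL
    exact h K hK m (momRel_trans M hij hm) g (hLK m ▸ hg) p
  | conSO a φ =>
    simp only [truth_imp, truth]
    intro h h'
    obtain ⟨L, hL, hL'⟩ := exists_optimal_soptimal M hM a i
    obtain ⟨g, hg⟩ := M.choice_ne a i.mom L hL.1
    have p := M.choice_sub a i.mom L hL.1 g hg
    exact h' L hL g hg p (h L hL' i.mom (momRel_refl M a i) g (subset_cluster_self M hL.1 hg) p)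
  | inN a φ =>
    simp only [truth_imp, truth]
    intro h
    refine ⟨_, M.tau_univ a i, ⟨i, self_mem_exAnte M a i⟩, ?_⟩
    rintro j ⟨g, q, e⟩
    obtain ⟨g', q', e'⟩ := M.unifH a _ _ ((M.epi_equiv a).symm e) j.hist j.mem
    exact h g' q' j ((M.epi_equiv a).symm e')
  | ki a φ =>
    simp only [truth_imp, truth]
    intro h g p j e
    rwa [← M.tau_ki a i j ((exAnte_eq_of_mom_eq M a i g p).symm.trans (exAnte_eq_of_epi M e))]
  | mp _ _ ih₁ ih₂ => exact (truth_imp M _ _ i).1 (ih₁ M hM i) (ih₂ M hM i)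
  | subst σ _ ih =>
    exact (truth_subst M σ _ i).2 (ih { M with val := fun n => {j | truth M (σ n) j} } hM i)
  | necBox _ ih => exact fun _ _ => ih M hM _
  | necStit a _ ih => exact fun _ _ _ _ _ _ => ih M hM _
  | necKnow a _ ih => exact fun j _ => ih M hM j
  | necInt a _ ih =>
    exact ⟨_, M.tau_univ a i, ⟨i, self_mem_exAnte M a i⟩, fun j _ => ih M hM j⟩
  | necOO a _ ih => exact fun _ _ _ _ _ => ih M hM _
  | necOS a _ ih => exact fun _ _ _ _ _ _ _ => ih M hM _

end IEAUST
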